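/- Fix (z,w) ∈ Λ with z ∉ {0,1} and w ∉ {0,1}. Then for all sufficiently large n ∈ ℕ and every (x,y) ∈ Λ: Tⁿ(x,y) ∈ [z−b^{−λ(n)}, z+b^{−λ(n)}] × [w−b^{−ξ(n)}, w+b^{−ξ(n)}] if and only if there exists t ∈ Jⁿ such that |x − f_t(z,w)_1| ≤ b^{−λ(n)−n} and |y − f_t(z,w)_2| ≤ b^{−ξ(n)−n}. -/

import Mathlib

open Set Filter Topology MeasureTheory
open scoped ENNReal NNReal Topology

noncomputable section

namespace ShrinkingRect

/-- The real number with 1-indexed base-`b` digit sequence `u` (digit `i` is `u i` for `i ≥ 1`). -/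
def val (b : ℕ) (u : ℕ → ℕ) : ℝ := ∑' i : ℕ, (u (i + 1) : ℝ) / (b : ℝ) ^ (i + 1)

/-- The self-similar carpet `Λ` with digit set `J ⊆ {0,…,b−1}²`. -/
def carpet (b : ℕ) (J : Finset (ℕ × ℕ)) : Set (ℝ × ℝ) :=
  {p | ∃ d : ℕ → ℕ × ℕ, (∀ i, 1 ≤ i → d i ∈ J) ∧
    p = (val b (fun i => (d i).1), val b (fun i => (d i).2))}

/-- `J₂(a)`: the digits of `J` lying in row `a`. -/
def J2 (J : Finset (ℕ × ℕ)) (a : ℕ) : Finset (ℕ × ℕ) := J.filter fun p => p.2 = a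

/-- The contraction `f_{u,v}(x,y) = ((x+u)/b, (y+v)/b)`. -/
def fmap (b : ℕ) (uv : ℕ × ℕ) (p : ℝ × ℝ) : ℝ × ℝ :=
  ((p.1 + (uv.1 : ℝ)) / b, (p.2 + (uv.2 : ℝ)) / b)

/-- `f_t = f_{u₁,v₁} ∘ ⋯ ∘ f_{uₙ,vₙ}` for a finite word `t = ((u₁,v₁),…,(uₙ,vₙ))`. -/
def fword (b : ℕ) (t : List (ℕ × ℕ)) (p : ℝ × ℝ) : ℝ × ℝ :=
  t.foldr (fmap b) p

/-- The limsup set `W_{λ,ξ}(z,w)`. -/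
def Wset (b : ℕ) (J : Finset (ℕ × ℕ)) (lam xi : ℕ → ℕ) (z w : ℝ) : Set (ℝ × ℝ) :=
  {p | p ∈ carpet b J ∧
    {t : List (ℕ × ℕ) | t ≠ [] ∧ (∀ e ∈ t, e ∈ J) ∧
      |p.1 - (fword b t (z, w)).1| ≤ (b : ℝ) ^ (-(lam t.length : ℤ) - (t.length : ℤ)) ∧
      |p.2 - (fword b t (z, w)).2| ≤ (b : ℝ) ^ (-(xi t.length : ℤ) - (t.length : ℤ))}.Infinite}

/-- The closeness condition (in one coordinate) defining `M_n(z,w)`: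
`xd` is the digit string of the point, `zd` that of the centre, `L` is `λ(n)` or `ξ(n)`. -/
def closeCond (b L n : ℕ) (zd xd : ℕ → ℕ) : Prop :=
  (∀ i, 1 ≤ i → i < L → xd (i + n) = zd i) ∨
  (∃ j, 1 ≤ j ∧ j < L ∧ (∀ i, 1 ≤ i → i ≤ j - 1 → xd (i + n) = zd i) ∧
    (((xd (j + n) : ℤ) - (zd j : ℤ) = -1 ∧
        ∀ i, j + 1 ≤ i → i < L → (xd (i + n) : ℤ) - (zd i : ℤ) = (b : ℤ) - 1) ∨
     ((xd (j + n) : ℤ) - (zd j : ℤ) = 1 ∧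
        ∀ i, j + 1 ≤ i → i < L → (zd i : ℤ) - (xd (i + n) : ℤ) = (b : ℤ) - 1)))

/-- A choice of representative digit sequences for the points of the carpet: each point of `Λ`
gets a digit sequence in `J` representing it, whose partial products of row cardinalities
`∏ #J₂(y_i)` are eventually maximal among all representations of that point. -/
structure RepMap (b : ℕ) (J : Finset (ℕ × ℕ)) where
  rep : ℝ × ℝ → ℕ → ℕ × ℕ
  mem_J : ∀ p ∈ carpet b J, ∀ i, 1 ≤ i → rep p i ∈ J
  eq_val : ∀ p ∈ carpet b J,
    p = (val b (fun i => (rep p i).1), val b (fun i => (rep p i).2))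
  maximal : ∀ p ∈ carpet b J, ∀ d : ℕ → ℕ × ℕ, (∀ i, 1 ≤ i → d i ∈ J) →
    p = (val b (fun i => (d i).1), val b (fun i => (d i).2)) →
    ∃ N₀ : ℕ, ∀ N, N₀ ≤ N →
      ∏ i ∈ Finset.Icc 1 N, (J2 J (d i).2).card ≤
        ∏ i ∈ Finset.Icc 1 N, (J2 J (rep p i).2).card

/-- The expanding map `T(x,y) = (bx − x₁, by − y₁)`, where `(x_i,y_i)` is the representative
digit sequence of `(x,y)`. -/
def Tmap {b : ℕ} {J : Finset (ℕ × ℕ)} (R : RepMap b J) (p : ℝ × ℝ) : ℝ × ℝ :=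
  ((b : ℝ) * p.1 - ((R.rep p 1).1 : ℝ), (b : ℝ) * p.2 - ((R.rep p 1).2 : ℝ))

/-- The shrinking target set `Λ_{λ,ξ}(z,w)`. -/
def targetSet {b : ℕ} {J : Finset (ℕ × ℕ)} (R : RepMap b J) (lam xi : ℕ → ℕ)
    (z w : ℝ) : Set (ℝ × ℝ) :=
  {p | p ∈ carpet b J ∧ ∃ᶠ n in atTop,
    ((Tmap R)^[n] p).1 ∈ Icc (z - (b : ℝ) ^ (-(lam n : ℤ))) (z + (b : ℝ) ^ (-(lam n : ℤ))) ∧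
    ((Tmap R)^[n] p).2 ∈ Icc (w - (b : ℝ) ^ (-(xi n : ℤ))) (w + (b : ℝ) ^ (-(xi n : ℤ)))}

/-- The set `M_n(z,w)` (as a set of points of `Λ`, via representative sequences). -/
def Mset {b : ℕ} {J : Finset (ℕ × ℕ)} (R : RepMap b J) (lam xi : ℕ → ℕ)
    (zw : ℝ × ℝ) (n : ℕ) : Set (ℝ × ℝ) :=
  {p | p ∈ carpet b J ∧
    closeCond b (lam n) n (fun i => (R.rep zw i).1) (fun i => (R.rep p i).1) ∧
    closeCond b (xi n) n (fun i => (R.rep zw i).2) (fun i => (R.rep p i).2)}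

/-- `p_{n,j}(a,y) = #{λ(n) ≤ i ≤ j : y_{i+n} = a}`. -/
def pcount {b : ℕ} {J : Finset (ℕ × ℕ)} (R : RepMap b J) (lam : ℕ → ℕ)
    (p : ℝ × ℝ) (a n j : ℕ) : ℕ :=
  ((Finset.Icc (lam n) j).filter fun i => (R.rep p (i + n)).2 = a).card

/-- `A_{n,j}(z,w) = max_{(x,y) ∈ M_n(z,w)} Σ_a p_{n,j}(a,y) log #J₂(a)`. -/
def Aval {b : ℕ} {J : Finset (ℕ × ℕ)} (R : RepMap b J) (lam xi : ℕ → ℕ)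
    (zw : ℝ × ℝ) (n j : ℕ) : ℝ :=
  sSup ((fun p => ∑ a ∈ Finset.range b,
    (pcount R lam p a n j : ℝ) * Real.log ((J2 J a).card)) '' Mset R lam xi zw n)

/-- `s_n = min{ (n log #J + A_{n,j}(z,w)) / ((n+j) log b) : λ(n) ≤ j ≤ ξ(n) }`. -/
def sval {b : ℕ} {J : Finset (ℕ × ℕ)} (R : RepMap b J) (lam xi : ℕ → ℕ)
    (zw : ℝ × ℝ) (n : ℕ) : ℝ :=
  sInf ((fun j : ℕ => ((n : ℝ) * Real.log J.card + Aval R lam xi zw n j) /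
    (((n : ℝ) + (j : ℝ)) * Real.log b)) '' Set.Icc (lam n) (xi n))

/-- `#{1 ≤ i ≤ n : u i = a}`. -/
def freqCount (u : ℕ → ℕ) (a n : ℕ) : ℕ := ((Finset.Icc 1 n).filter fun i => u i = a).card

/-- The second-coordinate digit string of the representative sequence of a point. -/
def wdig {b : ℕ} {J : Finset (ℕ × ℕ)} (R : RepMap b J) (zw : ℝ × ℝ) (i : ℕ) : ℕ :=
  (R.rep zw i).2

lemma summable_digits {b : ℕ} (hb : 2 ≤ b) {u : ℕ → ℕ} (hu : ∀ i, 1 ≤ i → u i < b) :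
    Summable fun i : ℕ => (u (i + 1) : ℝ) / (b : ℝ) ^ (i + 1) := by
  have hb1 : (1 : ℝ) < b := by exact_mod_cast hb
  refine Summable.of_nonneg_of_le (fun i => by positivity) (fun i => ?_)
    (summable_geometric_of_lt_one (inv_nonneg.2 (Nat.cast_nonneg b)) (inv_lt_one_of_one_lt₀ hb1))
  have h : (u (i + 1) : ℝ) ≤ b := by exact_mod_cast (hu (i + 1) (by omega)).le
  rw [inv_pow, div_le_iff₀ (by positivity), pow_succ, inv_mul_cancel_left₀ (by positivity)]
  exact h

lemma val_nonneg (b : ℕ) (u : ℕ → ℕ) : 0 ≤ val b u :=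
  tsum_nonneg fun _ => by positivity

lemma val_le_one {b : ℕ} (hb : 2 ≤ b) {u : ℕ → ℕ} (hu : ∀ i, 1 ≤ i → u i < b) :
    val b u ≤ 1 := by
  have hb1 : (1 : ℝ) < b := by exact_mod_cast hb
  have hs := hasSum_geometric_of_lt_one (inv_nonneg.2 (Nat.cast_nonneg b))
    (inv_lt_one_of_one_lt₀ hb1)
  have hg : HasSum (fun i : ℕ => ((b : ℝ) - 1) / (b : ℝ) ^ (i + 1)) 1 := by
    have hsub : (b : ℝ) - 1 ≠ 0 := by linarith
    have hb0 : (b : ℝ) ≠ 0 := by positivity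
    have hsum : ((b : ℝ) - 1) / b * (1 - (b : ℝ)⁻¹)⁻¹ = 1 := by field_simp
    rw [← hsum]
    convert! hs.mul_left (((b : ℝ) - 1) / b) using 2 with i
    rw [inv_pow, pow_succ]
    field_simp
  refine (hasSum_le (fun i => ?_) (summable_digits hb hu).hasSum hg)
  have h : (u (i + 1) : ℝ) + 1 ≤ b := by exact_mod_cast hu (i + 1) (by omega)
  gcongr
  linarith

lemma mul_val_sub {b : ℕ} (hb : 2 ≤ b) {u : ℕ → ℕ} (hu : ∀ i, 1 ≤ i → u i < b) :
    (b : ℝ) * val b u - u 1 = val b fun i => u (i + 1) := by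
  have hb0 : (b : ℝ) ≠ 0 := by positivity
  rw [val, (summable_digits hb hu).tsum_eq_zero_add, mul_add, ← tsum_mul_left]
  simp only [zero_add, pow_one, mul_div_cancel₀ _ hb0, add_sub_cancel_left, val]
  refine tsum_congr fun i => ?_
  rw [pow_succ (b : ℝ) (i + 1)]
  field_simp

lemma digits_lt {b : ℕ} {J : Finset (ℕ × ℕ)} (hJ : J ⊆ Finset.range b ×ˢ Finset.range b)
    {d : ℕ → ℕ × ℕ} (hd : ∀ i, 1 ≤ i → d i ∈ J) :
    (∀ i, 1 ≤ i → (d i).1 < b) ∧ ∀ i, 1 ≤ i → (d i).2 < b := by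
  refine ⟨fun i hi => ?_, fun i hi => ?_⟩ <;>
    have h := Finset.mem_product.1 (hJ (hd i hi))
  · exact Finset.mem_range.1 h.1
  · exact Finset.mem_range.1 h.2

lemma carpet_subset_unit {b : ℕ} {J : Finset (ℕ × ℕ)} (hb : 2 ≤ b)
    (hJ : J ⊆ Finset.range b ×ˢ Finset.range b) :
    carpet b J ⊆ Icc (0 : ℝ) 1 ×ˢ Icc (0 : ℝ) 1 := by
  rintro p ⟨d, hd, rfl⟩
  obtain ⟨h1, h2⟩ := digits_lt hJ hd
  exact mk_mem_prod ⟨val_nonneg _ _, val_le_one hb h1⟩ ⟨val_nonneg _ _, val_le_one hb h2⟩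

lemma Tmap_mem_carpet {b : ℕ} {J : Finset (ℕ × ℕ)} (hb : 2 ≤ b)
    (hJ : J ⊆ Finset.range b ×ˢ Finset.range b) (R : RepMap b J) {p : ℝ × ℝ}
    (hp : p ∈ carpet b J) : Tmap R p ∈ carpet b J := by
  obtain ⟨h1, h2⟩ := digits_lt hJ (R.mem_J p hp)
  refine ⟨fun i => R.rep p (i + 1), fun i _ => R.mem_J p hp (i + 1) (by omega), ?_⟩
  have he := R.eq_val p hp
  rw [← mul_val_sub hb h1, ← mul_val_sub hb h2]
  exact Prod.ext (congrArg (fun q : ℝ × ℝ => (b : ℝ) * q.1 - (R.rep p 1).1) he)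
    (congrArg (fun q : ℝ × ℝ => (b : ℝ) * q.2 - (R.rep p 1).2) he)

lemma fmap_Tmap {b : ℕ} {J : Finset (ℕ × ℕ)} (hb : 2 ≤ b) (R : RepMap b J) (p : ℝ × ℝ) :
    fmap b (R.rep p 1) (Tmap R p) = p := by
  have hb0 : (b : ℝ) ≠ 0 := by positivity
  simp [fmap, Tmap, hb0]

/-- Following the orbit of `p` under `Tmap R` for `n` steps reads off a word of length `n` whose
branch maps the `n`-th iterate back to `p`. -/
lemma exists_word_fword_iterate {b : ℕ} {J : Finset (ℕ × ℕ)} (hb : 2 ≤ b)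
    (hJ : J ⊆ Finset.range b ×ˢ Finset.range b) (R : RepMap b J) (n : ℕ) :
    ∀ p ∈ carpet b J, (Tmap R)^[n] p ∈ carpet b J ∧
      ∃ t : List (ℕ × ℕ), t.length = n ∧ (∀ e ∈ t, e ∈ J) ∧
        fword b t ((Tmap R)^[n] p) = p := by
  induction n with
  | zero => exact fun p hp => ⟨hp, [], rfl, by simp, rfl⟩
  | succ n ih =>
    intro p hp
    obtain ⟨hq, t, hlen, ht, hf⟩ := ih _ (Tmap_mem_carpet hb hJ R hp)
    rw [Function.iterate_succ_apply]
    refine ⟨hq, R.rep p 1 :: t, by simp [hlen], ?_, ?_⟩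
    · simpa using ⟨R.mem_J p hp 1 le_rfl, fun a c h => ht (a, c) h⟩
    · calc fword b (R.rep p 1 :: t) ((Tmap R)^[n] (Tmap R p))
          = fmap b (R.rep p 1) (fword b t ((Tmap R)^[n] (Tmap R p))) := rfl
        _ = p := by rw [hf, fmap_Tmap hb]

lemma fword_eq_translate_div {b : ℕ} (hb : 2 ≤ b) (t : List (ℕ × ℕ)) :
    ∃ k l : ℤ, ∀ q : ℝ × ℝ, fword b t q =
      ((q.1 + k) / (b : ℝ) ^ t.length, (q.2 + l) / (b : ℝ) ^ t.length) := by
  have hb0 : (b : ℝ) ≠ 0 := by positivity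
  induction t with
  | nil => exact ⟨0, 0, fun q => by simp [fword]⟩
  | cons e t ih =>
    obtain ⟨k, l, h⟩ := ih
    refine ⟨k + e.1 * (b : ℤ) ^ t.length, l + e.2 * (b : ℤ) ^ t.length, fun q => ?_⟩
    have hq : fword b (e :: t) q = fmap b e (fword b t q) := rfl
    rw [hq, h]
    refine Prod.ext ?_ ?_ <;>
    · simp only [fmap, List.length_cons]
      push_cast
      field_simp
      ring

lemma abs_translate_div_sub_le_iff {b : ℕ} (hb : 2 ≤ b) (L n : ℕ) (x y k l : ℝ) :
    |(x + k) / (b : ℝ) ^ n - (y + l) / (b : ℝ) ^ n| ≤ (b : ℝ) ^ (-(L : ℤ) - (n : ℤ)) ↔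
      |x + k - (y + l)| ≤ (b : ℝ) ^ (-(L : ℤ)) := by
  have hb0 : (b : ℝ) ≠ 0 := by positivity
  have hpos : (0 : ℝ) < (b : ℝ) ^ n := by positivity
  rw [zpow_sub₀ hb0, zpow_natCast, ← sub_div, abs_div, abs_of_pos hpos,
    div_le_div_iff_of_pos_right hpos]

/-- An integer translate of a point of `[0,1]` that is close to an interior point is the point
itself. -/
lemma int_translate_eq_zero {x z ε : ℝ} {k l : ℤ} (hx : x ∈ Icc (0 : ℝ) 1) (h0 : ε < z)
    (h1 : ε < 1 - z) (h : |x + k - (z + l)| ≤ ε) : k = l := by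
  obtain ⟨ha, hc⟩ := abs_le.1 h
  obtain ⟨hx0, hx1⟩ := hx
  have h2 : k < l + 1 := by
    have : (k : ℝ) < l + 1 := by linarith
    exact_mod_cast this
  have h3 : l < k + 1 := by
    have : (l : ℝ) < k + 1 := by linarith
    exact_mod_cast this
  omega

lemma eventually_zpow_neg_lt {b : ℕ} (hb : 2 ≤ b) {lam : ℕ → ℕ} (hlam : Tendsto lam atTop atTop)
    {ε : ℝ} (hε : 0 < ε) : ∀ᶠ n in atTop, (b : ℝ) ^ (-(lam n : ℤ)) < ε := by
  have hb1 : (1 : ℝ) < b := by exact_mod_cast hb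
  have h := (tendsto_pow_atTop_nhds_zero_of_lt_one (inv_nonneg.2 (Nat.cast_nonneg b))
    (inv_lt_one_of_one_lt₀ hb1)).comp hlam
  filter_upwards [h.eventually (gt_mem_nhds hε)] with n hn
  simpa [zpow_neg, inv_pow] using hn

theorem stmt_8
    (b : ℕ) (J : Finset (ℕ × ℕ)) (hb : 2 ≤ b)
    (hJ : J ⊂ Finset.range b ×ˢ Finset.range b) (hJcard : 2 ≤ J.card)
    (R : RepMap b J) (lam xi : ℕ → ℕ)
    (hlam_pos : ∀ n, 1 ≤ lam n) (hle : ∀ n, lam n ≤ xi n)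
    (hlam_top : Tendsto lam atTop atTop)
    (z w : ℝ) (hzw : (z, w) ∈ carpet b J)
    (hz0 : z ≠ 0) (hz1 : z ≠ 1) (hw0 : w ≠ 0) (hw1 : w ≠ 1) :
    ∀ᶠ n in atTop, ∀ p ∈ carpet b J,
      ((((Tmap R)^[n] p).1 ∈
        Icc (z - (b : ℝ) ^ (-(lam n : ℤ))) (z + (b : ℝ) ^ (-(lam n : ℤ))) ∧
      ((Tmap R)^[n] p).2 ∈
        Icc (w - (b : ℝ) ^ (-(xi n : ℤ))) (w + (b : ℝ) ^ (-(xi n : ℤ)))) ↔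
      (∃ t : List (ℕ × ℕ), t.length = n ∧ (∀ e ∈ t, e ∈ J) ∧
        |p.1 - (fword b t (z, w)).1| ≤ (b : ℝ) ^ (-(lam n : ℤ) - (n : ℤ)) ∧
        |p.2 - (fword b t (z, w)).2| ≤ (b : ℝ) ^ (-(xi n : ℤ) - (n : ℤ)))) := by
  obtain ⟨⟨hz0', hz1'⟩, hw0', hw1'⟩ := carpet_subset_unit hb hJ.subset hzw
  have hzpos : 0 < z := lt_of_le_of_ne hz0' hz0.symm
  have hzlt : 0 < 1 - z := sub_pos.2 (lt_of_le_of_ne hz1' hz1)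
  have hwpos : 0 < w := lt_of_le_of_ne hw0' hw0.symm
  have hwlt : 0 < 1 - w := sub_pos.2 (lt_of_le_of_ne hw1' hw1)
  have hxi_top : Tendsto xi atTop atTop := tendsto_atTop_mono hle hlam_top
  have habs : ∀ x y ε : ℝ, x ∈ Icc (y - ε) (y + ε) ↔ |x - y| ≤ ε := fun x y ε => by
    rw [abs_le, mem_Icc]
    constructor <;> rintro ⟨h1, h2⟩ <;> constructor <;> linarith
  filter_upwards [eventually_zpow_neg_lt hb hlam_top hzpos,
    eventually_zpow_neg_lt hb hlam_top hzlt, eventually_zpow_neg_lt hb hxi_top hwpos,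
    eventually_zpow_neg_lt hb hxi_top hwlt] with n hn1 hn2 hn3 hn4 p hp
  obtain ⟨hq, t, rfl, ht, hf⟩ := exists_word_fword_iterate hb hJ.subset R n p hp
  obtain ⟨k, l, hkl⟩ := fword_eq_translate_div hb t
  generalize (Tmap R)^[t.length] p = q at hq hf ⊢
  obtain ⟨hq1, hq2⟩ := carpet_subset_unit hb hJ.subset hq
  rw [habs, habs, ← hf, hkl q]
  constructor
  · rintro ⟨h1, h2⟩
    refine ⟨t, rfl, ht, ?_, ?_⟩ <;>
      rw [hkl, abs_translate_div_sub_le_iff hb, add_sub_add_right_eq_sub] <;> assumption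
  · rintro ⟨s, hs, -, h1, h2⟩
    obtain ⟨k', l', hkl'⟩ := fword_eq_translate_div hb s
    rw [hkl', hs, abs_translate_div_sub_le_iff hb] at h1 h2
    obtain rfl := int_translate_eq_zero hq1 hn1 hn2 h1
    obtain rfl := int_translate_eq_zero hq2 hn3 hn4 h2
    rw [add_sub_add_right_eq_sub] at h1 h2
    exact ⟨h1, h2⟩

end ShrinkingRect
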